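/- For every σ > 2, the complement ℝ \ 𝓑 of the Brjuno set has zero Hausdorff H^{h¹_σ}-measure with respect to the gauge function h¹_σ(t) = (ln(1/t))^{-2} · (ln ln(1/t))^{-σ} for 0 < t ≤ e^{-2} (and h¹_σ(0) = 0). -/

import Mathlib

open MeasureTheory Filter ENNReal

/-- The `n`-th denominator of the continued fraction expansion of `α`. -/
noncomputable def cfDen (α : ℝ) (n : ℕ) : ℝ := (GenContFract.of α).dens n

/-- The Brjuno set: irrational numbers whose continued fraction denominators satisfy
`∑_{n≥1} (ln Q_{n+1})/Q_n < +∞`. -/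
def BrjunoSet : Set ℝ :=
  {α | Irrational α ∧
    Summable (fun n : ℕ => Real.log (cfDen α (n + 2)) / cfDen α (n + 1))}

/-- The gauge function `h¹_σ(t) = (ln(1/t))^{-2} · (ln ln(1/t))^{-σ}` for `0 < t ≤ e^{-2}`,
with `h¹_σ(0) = 0` (the value for `t > e^{-2}` is irrelevant for the Hausdorff measure and is
set to the constant `h¹_σ(e^{-2})`). -/
noncomputable def brjunoGauge (σ : ℝ) : ℝ≥0∞ → ℝ≥0∞ := fun t =>
  if t = 0 then 0
  else if t ≤ ENNReal.ofReal (Real.exp (-2)) then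
    ENNReal.ofReal ((Real.log (1 / t.toReal)) ^ (-2 : ℝ) *
      (Real.log (Real.log (1 / t.toReal))) ^ (-σ))
  else ENNReal.ofReal ((2 : ℝ) ^ (-2 : ℝ) * (Real.log 2) ^ (-σ))

open Topology

/-- A sequence eventually dominated by the decrements of a nonnegative potential is summable. -/
theorem summable_of_eventually_le_sub {x Φ : ℕ → ℝ} (hx : ∀ n, 0 ≤ x n) (hΦ : ∀ n, 0 ≤ Φ n)
    (h : ∀ᶠ n in atTop, x n ≤ Φ n - Φ (n + 1)) : Summable x := by
  obtain ⟨N, hN⟩ := eventually_atTop.1 h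
  rw [← summable_nat_add_iff N]
  refine summable_of_sum_range_le (c := Φ N) (fun n => hx _) fun n => ?_
  have key : ∑ i ∈ Finset.range n, x (i + N) ≤ Φ N - Φ (n + N) := by
    induction n with
    | zero => simp
    | succ n ih =>
      rw [Finset.sum_range_succ]
      have := hN (n + N) (by omega)
      rw [show n + 1 + N = n + N + 1 by ring]
      linarith
  linarith [hΦ (n + N)]

/-- If `Q` grows at least geometrically and `log (Q (n + 1)) ≤ Q n / √(log (Q n))` eventually, then
the Brjuno sum of `Q` converges. -/
theorem summable_log_div_of_eventually_le {Q : ℕ → ℝ} (h1 : ∀ n, 1 ≤ Q n) (hmono : Monotone Q)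
    (h2 : ∀ n, 2 * Q n ≤ Q (n + 2)) (htop : Tendsto Q atTop atTop)
    (h : ∀ᶠ n in atTop, Real.log (Q (n + 1)) ≤ Q n / √(Real.log (Q n))) :
    Summable fun n => Real.log (Q (n + 1)) / Q n := by
  have hlog : ∀ᶠ x : ℝ in atTop, Real.log x ≤ √x / 4 := by
    have := (isLittleO_log_rpow_atTop (r := 1 / 2) (by norm_num)).bound
      (show (0 : ℝ) < 1 / 4 by norm_num)
    filter_upwards [this, eventually_ge_atTop 1] with x hx hx1
    rw [Real.norm_of_nonneg (Real.log_nonneg hx1), Real.norm_of_nonneg (by positivity),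
      ← Real.sqrt_eq_rpow] at hx
    linarith
  refine summable_of_eventually_le_sub
    (Φ := fun n => 4 * (1 / √(Q n) + 1 / √(Q (n + 1))) + 2 * (1 / √(Real.log (Q n))))
    (fun n => div_nonneg (Real.log_nonneg (h1 _)) (zero_le_one.trans (h1 n)))
    (fun n => by positivity) ?_
  filter_upwards [h, htop.eventually hlog, htop.eventually (eventually_gt_atTop 1)]
    with n hn hln hn1
  have hQ : 0 < Q n := by linarith
  have hs : 0 < √(Q n) := Real.sqrt_pos.2 hQ
  have hss : √(Q n) * √(Q n) = Q n := Real.mul_self_sqrt hQ.le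
  have hl : 0 < Real.log (Q n) := Real.log_pos hn1
  have hl' : Real.log (Q n) ≤ Real.log (Q (n + 1)) := Real.log_le_log hQ (hmono n.le_succ)
  have hsl : 0 < √(Real.log (Q n)) := Real.sqrt_pos.2 hl
  have hd1 : 1 / √(Q n) ≤ 4 * (1 / √(Q n) - 1 / √(Q (n + 2))) := by
    have : 4 / 3 * √(Q n) ≤ √(Q (n + 2)) := by
      apply Real.le_sqrt_of_sq_le
      nlinarith [h2 n]
    have : 1 / √(Q (n + 2)) ≤ 1 / (4 / 3 * √(Q n)) :=
      one_div_le_one_div_of_le (by positivity) this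
    have e : 1 / (4 / 3 * √(Q n)) = 3 / 4 * (1 / √(Q n)) := by field_simp
    linarith
  have hd2 : 1 / √(Real.log (Q (n + 1))) ≤ 1 / √(Real.log (Q n)) :=
    one_div_le_one_div_of_le hsl (Real.sqrt_le_sqrt hl')
  have hp : 0 < 1 / √(Q n) := by positivity
  change _ ≤ 4 * (1 / √(Q n) + 1 / √(Q (n + 1))) + 2 * (1 / √(Real.log (Q n))) -
    (4 * (1 / √(Q (n + 1)) + 1 / √(Q (n + 2))) + 2 * (1 / √(Real.log (Q (n + 1)))))
  rcases le_total (Real.log (Q (n + 1))) √(Q n) with hc | hc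
  · have : Real.log (Q (n + 1)) / Q n ≤ 1 / √(Q n) := by
      rw [div_le_div_iff₀ hQ hs]
      nlinarith
    linarith
  · have hx : Real.log (Q (n + 1)) / Q n ≤ 1 / √(Real.log (Q n)) := by
      rw [div_le_iff₀ hQ]
      calc _ ≤ _ := hn
        _ = _ := by ring
    have : 2 * √(Real.log (Q n)) ≤ √(Real.log (Q (n + 1))) := by
      apply Real.le_sqrt_of_sq_le
      rw [mul_pow, Real.sq_sqrt hl.le]
      linarith
    have : 1 / √(Real.log (Q (n + 1))) ≤ 1 / (2 * √(Real.log (Q n))) :=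
      one_div_le_one_div_of_le (by positivity) this
    have e : 1 / (2 * √(Real.log (Q n))) = 1 / 2 * (1 / √(Real.log (Q n))) := by field_simp
    linarith

theorem not_terminatedAt_of_irrational {α : ℝ} (hα : Irrational α) (n : ℕ) :
    ¬ (GenContFract.of α).TerminatedAt n := by
  intro h
  obtain ⟨q, hq⟩ := (GenContFract.terminates_iff_rat α).1 ⟨n, h⟩
  exact hα ⟨q, hq.symm⟩

theorem exists_int_contsAux (α : ℝ) (n : ℕ) :
    (∃ a b : ℤ, (GenContFract.of α).contsAux n = ⟨(a : ℝ), (b : ℝ)⟩) ∧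
      ∃ a b : ℤ, (GenContFract.of α).contsAux (n + 1) = ⟨(a : ℝ), (b : ℝ)⟩ := by
  induction n with
  | zero =>
    refine ⟨⟨1, 0, ?_⟩, ⟨⌊α⌋, 1, ?_⟩⟩
    · simp [GenContFract.contsAux]
    · simp [GenContFract.contsAux, GenContFract.of_h_eq_floor]
  | succ n ih =>
    obtain ⟨⟨a, b, hab⟩, ⟨c, d, hcd⟩⟩ := ih
    refine ⟨⟨c, d, hcd⟩, ?_⟩
    rcases hs : (GenContFract.of α).s.get? n with _ | gp
    · exact ⟨c, d, by rw [GenContFract.contsAux_stable_step_of_terminated hs, hcd]⟩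
    · obtain ⟨ha, z, hz⟩ := GenContFract.of_partNum_eq_one_and_exists_int_partDen_eq hs
      refine ⟨z * c + a, z * d + b, ?_⟩
      rw [GenContFract.contsAux_recurrence hs hab hcd, ha, hz]
      push_cast
      simp

theorem cfDen_one_le (α : ℝ) (n : ℕ) : 1 ≤ cfDen α n := by
  have hm : Monotone (cfDen α) := monotone_nat_of_le_succ fun n => GenContFract.of_den_mono
  calc (1 : ℝ) = cfDen α 0 := by simp [cfDen, GenContFract.zeroth_den_eq_one]
    _ ≤ _ := hm n.zero_le

theorem exists_nat_cfDen (α : ℝ) (n : ℕ) :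
    ∃ (p : ℤ) (q : ℕ), cfDen α n = q ∧ (GenContFract.of α).convs n = p / q := by
  obtain ⟨-, a, b, h⟩ := exists_int_contsAux α n
  have hb : cfDen α n = b := by
    rw [cfDen, GenContFract.den_eq_conts_b, GenContFract.nth_cont_eq_succ_nth_contAux, h]
  have hb0 : 0 ≤ b := by
    have := cfDen_one_le α n
    rw [hb] at this
    exact_mod_cast zero_le_one.trans this
  lift b to ℕ using hb0
  refine ⟨a, b, by simpa using hb, ?_⟩
  rw [GenContFract.conv_eq_conts_a_div_conts_b, GenContFract.nth_cont_eq_succ_nth_contAux, h]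
  simp

theorem two_mul_cfDen_le {α : ℝ} (hα : Irrational α) (n : ℕ) :
    2 * cfDen α n ≤ cfDen α (n + 2) := by
  rcases hs : (GenContFract.of α).s.get? (n + 1) with _ | gp
  · exact absurd hs (not_terminatedAt_of_irrational hα (n + 1))
  · have hb := GenContFract.of_one_le_get?_partDen (GenContFract.partDen_eq_s_b hs)
    have ha := (GenContFract.of_partNum_eq_one_and_exists_int_partDen_eq hs).1
    have hr := GenContFract.dens_recurrence hs rfl rfl
    have hm : cfDen α n ≤ cfDen α (n + 1) := GenContFract.of_den_mono
    have h1 := cfDen_one_le α (n + 1)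
    change cfDen α (n + 2) = gp.b * cfDen α (n + 1) + gp.a * cfDen α n at hr
    rw [hr, ha]
    nlinarith

theorem tendsto_cfDen_atTop {α : ℝ} (hα : Irrational α) : Tendsto (cfDen α) atTop atTop := by
  refine tendsto_atTop_mono' _ ?_ tendsto_natCast_atTop_atTop
  filter_upwards [eventually_ge_atTop 5] with n hn
  calc (n : ℝ) ≤ (Nat.fib n : ℝ) := mod_cast Nat.le_fib_self hn
    _ ≤ (Nat.fib (n + 1) : ℝ) := mod_cast Nat.fib_le_fib_succ
    _ ≤ _ := GenContFract.succ_nth_fib_le_of_nth_den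
      (Or.inr (not_terminatedAt_of_irrational hα _))

/-- An irrational non-Brjuno number is approximated within `exp (-q / √(log q))` by fractions
`p / q` of arbitrarily large denominator. -/
theorem exists_approx_of_not_brjuno {α : ℝ} (hα : Irrational α) (hB : α ∉ BrjunoSet) (N : ℕ) :
    ∃ q ≥ N, ∃ p : ℤ, 0 < q ∧ |α - p / q| ≤ Real.exp (-(q / √(Real.log q))) := by
  have hmono : Monotone (cfDen α) := monotone_nat_of_le_succ fun n => GenContFract.of_den_mono
  have hfreq : ¬ ∀ᶠ n in atTop,
      Real.log (cfDen α (n + 1)) ≤ cfDen α n / √(Real.log (cfDen α n)) := by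
    intro h
    have hsum := summable_log_div_of_eventually_le (cfDen_one_le α) hmono
      (two_mul_cfDen_le hα) (tendsto_cfDen_atTop hα) h
    exact hB ⟨hα, hsum.comp_injective (add_left_injective 1)⟩
  obtain ⟨n, hn, hnN⟩ := ((not_eventually.1 hfreq).and_eventually
    ((tendsto_cfDen_atTop hα).eventually (eventually_ge_atTop (N : ℝ)))).exists
  rw [not_le] at hn
  obtain ⟨p, q, hq, hpq⟩ := exists_nat_cfDen α n
  have h1 := cfDen_one_le α n
  have h1' := cfDen_one_le α (n + 1)
  have happ : |α - p / q| ≤ 1 / (cfDen α n * cfDen α (n + 1)) := by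
    rw [← hpq]
    exact GenContFract.abs_sub_convs_le (not_terminatedAt_of_irrational hα n)
  rw [hq] at hnN hn
  refine ⟨q, mod_cast hnN, p, ?_, happ.trans ?_⟩
  · rw [hq] at h1
    exact_mod_cast zero_lt_one.trans_le h1
  · rw [Real.lt_log_iff_exp_lt (by linarith)] at hn
    rw [Real.exp_neg, ← one_div]
    refine one_div_le_one_div_of_le (Real.exp_pos _) ?_
    nlinarith

theorem brjunoGauge_zero (σ : ℝ) : brjunoGauge σ 0 = 0 := by simp [brjunoGauge]

theorem mkMetric_brjunoGauge_countable (σ : ℝ) {s : Set ℝ} (hs : s.Countable) :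
    Measure.mkMetric (brjunoGauge σ) s = 0 := by
  have := hs.to_subtype
  have h := Measure.mkMetric_le_liminf_tsum (β := ℕ) (ι := fun _ => s) s (l := atTop)
    (fun _ => 0) tendsto_const_nhds (fun _ i => {(i : ℝ)}) (by simp)
    (by simp) (brjunoGauge σ)
  simpa [brjunoGauge_zero] using h

theorem brjunoGauge_approx_le {σ : ℝ} (hσ : 2 < σ) :
    ∀ᶠ q : ℕ in atTop,
      brjunoGauge σ (ENNReal.ofReal (2 * Real.exp (-(q / √(Real.log q))))) ≤
        ENNReal.ofReal (4 * (1 / 2) ^ (-σ) * Real.log q ^ (1 - σ) / (q : ℝ) ^ 2) := by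
  have hlog : ∀ᶠ x : ℝ in atTop, Real.log x ≤ x / 4 := by
    filter_upwards [Real.isLittleO_log_id_atTop.bound (show (0 : ℝ) < 1 / 4 by norm_num),
      eventually_ge_atTop 1] with x hx hx1
    rw [Real.norm_of_nonneg (Real.log_nonneg hx1), id, Real.norm_of_nonneg (by positivity)] at hx
    linarith
  filter_upwards [tendsto_natCast_atTop_atTop.eventually hlog, eventually_ge_atTop 4] with q hlq hq4
  have hq : (4 : ℝ) ≤ q := mod_cast hq4
  set x : ℝ := (q : ℝ)
  have hl : 0 < Real.log x := Real.log_pos (by linarith)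
  set ℓ := Real.log x with hℓ
  have hx : 0 < x := by linarith
  have hsx2 : 2 ≤ √x := Real.le_sqrt_of_sq_le (by linarith)
  have hsl : 0 < √ℓ := Real.sqrt_pos.2 hl
  have hsle : 2 * √ℓ ≤ √x := by
    apply Real.le_sqrt_of_sq_le
    rw [mul_pow, Real.sq_sqrt hl.le]
    linarith
  have hA : √x ≤ x / (2 * √ℓ) := by
    rw [le_div_iff₀ (by positivity)]
    nlinarith [Real.mul_self_sqrt hx.le]
  have hL : Real.log (1 / (2 * Real.exp (-(x / √ℓ)))) = x / √ℓ - Real.log 2 := by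
    rw [one_div, Real.log_inv, Real.log_mul (by norm_num) (Real.exp_pos _).ne', Real.log_exp]
    ring
  have hhalf : x / √ℓ = x / (2 * √ℓ) + x / (2 * √ℓ) := by field_simp; ring
  have hlog2 : Real.log 2 ≤ 1 := by linarith [Real.log_two_lt_d9]
  set L := x / √ℓ - Real.log 2 with hLdef
  have hLA : x / (2 * √ℓ) ≤ L := by linarith
  have hL2 : 2 ≤ L := by linarith
  have hpos : 0 < 2 * Real.exp (-(x / √ℓ)) := by positivity
  have hsmall : 2 * Real.exp (-(x / √ℓ)) ≤ Real.exp (-2) := by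
    rw [← Real.log_le_log_iff hpos (Real.exp_pos _), Real.log_exp]
    rw [one_div, Real.log_inv] at hL
    linarith
  rw [brjunoGauge, if_neg (by simpa using hpos), if_pos (ENNReal.ofReal_le_ofReal hsmall),
    ENNReal.toReal_ofReal hpos.le, hL]
  apply ENNReal.ofReal_le_ofReal
  have hlL : 1 / 2 * ℓ ≤ Real.log L := by
    have : Real.log √x ≤ Real.log L := Real.log_le_log (by positivity) (hA.trans hLA)
    rw [Real.log_sqrt hx.le] at this
    linarith
  have hf1 : L ^ (-2 : ℝ) ≤ 4 * ℓ / x ^ 2 := by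
    calc L ^ (-2 : ℝ) ≤ (x / (2 * √ℓ)) ^ (-2 : ℝ) :=
          Real.rpow_le_rpow_of_nonpos (by positivity) hLA (by norm_num)
      _ = 4 * ℓ / x ^ 2 := by
          rw [Real.rpow_neg (by positivity), Real.rpow_two, div_pow, mul_pow, Real.sq_sqrt hl.le,
            inv_div]
          norm_num
  have hf2 : Real.log L ^ (-σ) ≤ (1 / 2) ^ (-σ) * ℓ ^ (-σ) := by
    rw [← Real.mul_rpow (by norm_num) hl.le]
    exact Real.rpow_le_rpow_of_nonpos (by positivity) hlL (by linarith)
  calc _ ≤ 4 * ℓ / x ^ 2 * ((1 / 2) ^ (-σ) * ℓ ^ (-σ)) :=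
        mul_le_mul hf1 hf2 (Real.rpow_nonneg (by linarith) _) (by positivity)
    _ = _ := by
        rw [show 1 - σ = 1 + -σ by ring, Real.rpow_add hl, Real.rpow_one]
        ring

theorem summable_log_rpow_div {s : ℝ} (hs : s < -1) :
    Summable fun n : ℕ => Real.log n ^ s / n := by
  rw [← summable_condensed_iff_of_eventually_nonneg]
  · have : (fun k : ℕ => (2 : ℝ) ^ k * (Real.log ((2 ^ k : ℕ) : ℝ) ^ s / ((2 ^ k : ℕ) : ℝ))) =
        fun k : ℕ => Real.log 2 ^ s * (k : ℝ) ^ s := by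
      ext k
      push_cast
      rw [Real.log_pow, Real.mul_rpow (by positivity) (by positivity)]
      field_simp
    rw [this]
    exact (Real.summable_nat_rpow.2 hs).mul_left _
  · exact Eventually.of_forall fun n => by
      have := Real.log_natCast_nonneg n
      simp only [Pi.zero_apply]
      positivity
  · filter_upwards [eventually_ge_atTop 2] with n hn
    have hn' : (2 : ℝ) ≤ n := mod_cast hn
    have hl : 0 < Real.log n := Real.log_pos (by linarith)
    have hle : (n : ℝ) ≤ ((n + 1 : ℕ) : ℝ) := by push_cast; linarith
    exact div_le_div₀ (by positivity)
      (Real.rpow_le_rpow_of_nonpos hl (Real.log_le_log (by linarith) hle) (by linarith))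
      (by linarith) hle

/-- Covering interval of the fraction `p / q`, present only if `|p| ≤ K q`. -/
noncomputable def approxInterval (K q : ℕ) (p : ℤ) : Set ℝ :=
  if p ∈ Finset.Icc (-(K * q : ℤ)) (K * q) then
    Set.Icc ((p : ℝ) / q - Real.exp (-(q / √(Real.log q))))
      ((p : ℝ) / q + Real.exp (-(q / √(Real.log q))))
  else ∅

theorem ediam_approxInterval_le (K q : ℕ) (p : ℤ) :
    Metric.ediam (approxInterval K q p) ≤
      ENNReal.ofReal (2 * Real.exp (-(q / √(Real.log q)))) := by
  rw [approxInterval]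
  split_ifs
  · rw [Real.ediam_Icc]
    exact ENNReal.ofReal_le_ofReal (by linarith)
  · simp

theorem tsum_brjunoGauge_approxInterval (σ : ℝ) (K q : ℕ) :
    ∑' p : ℤ, brjunoGauge σ (Metric.ediam (approxInterval K q p)) =
      ENNReal.ofReal (2 * K * q + 1) *
        brjunoGauge σ (ENNReal.ofReal (2 * Real.exp (-(q / √(Real.log q))))) := by
  rw [tsum_eq_sum (s := Finset.Icc (-(K * q : ℤ)) (K * q))]
  · have : ∀ p ∈ Finset.Icc (-(K * q : ℤ)) (K * q),
        brjunoGauge σ (Metric.ediam (approxInterval K q p)) =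
          brjunoGauge σ (ENNReal.ofReal (2 * Real.exp (-(q / √(Real.log q))))) := by
      intro p hp
      rw [approxInterval, if_pos hp, Real.ediam_Icc]
      congr 2
      ring
    rw [Finset.sum_congr rfl this, Finset.sum_const, nsmul_eq_mul, Int.card_Icc]
    congr 1
    rw [show ((K * q : ℤ) + 1 - -(K * q)).toNat = 2 * K * q + 1 by
      rw [show ((K * q : ℤ) + 1 - -(K * q)) = ((2 * K * q + 1 : ℕ) : ℤ) by push_cast; ring]
      exact Int.toNat_natCast _]
    rw [← ENNReal.ofReal_natCast]
    push_cast
    rfl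
  · intro p hp
    rw [approxInterval, if_neg hp, Metric.ediam_empty, brjunoGauge_zero]

theorem tendsto_exp_neg_div_sqrt_log :
    Tendsto (fun x : ℝ => Real.exp (-(x / √(Real.log x)))) atTop (𝓝 0) := by
  refine Real.tendsto_exp_neg_atTop_nhds_zero.comp ?_
  refine tendsto_atTop_mono' _ ?_ Real.tendsto_sqrt_atTop
  filter_upwards [eventually_gt_atTop 1] with x hx
  have hl : 0 < Real.log x := Real.log_pos hx
  rw [le_div_iff₀ (Real.sqrt_pos.2 hl)]
  calc √x * √(Real.log x) ≤ √x * √x := by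
        gcongr
        linarith [Real.log_le_sub_one_of_pos (show 0 < x by linarith)]
    _ = x := Real.mul_self_sqrt (by linarith)

theorem eventually_tsum_brjunoGauge_le {σ : ℝ} (hσ : 2 < σ) (K : ℕ) :
    ∀ᶠ q : ℕ in atTop, ∑' p : ℤ, brjunoGauge σ (Metric.ediam (approxInterval K q p)) ≤
      ENNReal.ofReal ((2 * K + 1) * (4 * (1 / 2) ^ (-σ)) * (Real.log q ^ (1 - σ) / q)) := by
  filter_upwards [brjunoGauge_approx_le hσ, eventually_ge_atTop 1] with q hq hq1
  have hq1' : (1 : ℝ) ≤ q := mod_cast hq1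
  have hl : 0 ≤ Real.log q := Real.log_natCast_nonneg q
  rw [tsum_brjunoGauge_approxInterval]
  refine (mul_le_mul_right hq _).trans ?_
  rw [← ENNReal.ofReal_mul (by positivity)]
  apply ENNReal.ofReal_le_ofReal
  calc _ ≤ ((2 * K + 1) * q : ℝ) *
        (4 * (1 / 2) ^ (-σ) * Real.log q ^ (1 - σ) / (q : ℝ) ^ 2) := by
        gcongr
        linarith
    _ = _ := by field_simp

theorem mkMetric_brjunoGauge_bounded {σ : ℝ} (hσ : 2 < σ) (M : ℕ) :
    Measure.mkMetric (brjunoGauge σ)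
      {α : ℝ | Irrational α ∧ α ∉ BrjunoSet ∧ |α| ≤ M} = 0 := by
  obtain ⟨N, hN⟩ := eventually_atTop.1 (eventually_tsum_brjunoGauge_le hσ (M + 1))
  set f : ℕ → ℝ := fun q =>
    (2 * (M + 1 : ℕ) + 1) * (4 * (1 / 2) ^ (-σ)) * (Real.log q ^ (1 - σ) / q)
  have hf : Summable f := (summable_log_rpow_div (by linarith)).mul_left _
  have htail := ENNReal.tendsto_sum_nat_add (fun q => ENNReal.ofReal (f q))
    hf.tsum_ofReal_ne_top
  obtain ⟨r, hr0, hr⟩ : ∃ r : ℕ → ℝ≥0∞, Tendsto r atTop (𝓝 0) ∧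
      ∀ n, ∀ i : ℕ × ℤ, Metric.ediam (approxInterval (M + 1) (i.1 + n) i.2) ≤ r n := by
    have ht : Tendsto (fun q : ℕ => ENNReal.ofReal (2 * Real.exp (-(q / √(Real.log q)))))
        atTop (𝓝 0) := by
      have := (tendsto_exp_neg_div_sqrt_log.comp tendsto_natCast_atTop_atTop).const_mul 2
      simpa using ENNReal.tendsto_ofReal this
    refine ⟨fun n => ⨆ k ≥ n, ENNReal.ofReal (2 * Real.exp (-(k / √(Real.log k)))), ?_, ?_⟩
    · rw [ENNReal.tendsto_nhds_zero] at ht ⊢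
      intro ε hε
      obtain ⟨m, hm⟩ := eventually_atTop.1 (ht ε hε)
      filter_upwards [eventually_ge_atTop m] with n hn
      exact iSup₂_le fun k hk => hm k (hn.trans hk)
    · intro n i
      exact (ediam_approxInterval_le _ _ _).trans
        (le_iSup₂ (f := fun k (_ : k ≥ n) =>
          ENNReal.ofReal (2 * Real.exp (-(k / √(Real.log k))))) (i.1 + n) (Nat.le_add_left _ _))
  have h := Measure.mkMetric_le_liminf_tsum (β := ℕ) (ι := fun _ => ℕ × ℤ)
    {α : ℝ | Irrational α ∧ α ∉ BrjunoSet ∧ |α| ≤ M} (l := atTop) r hr0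
    (fun n i => approxInterval (M + 1) (i.1 + n) i.2)
    (Eventually.of_forall hr) ?_ (brjunoGauge σ)
  · refine le_antisymm (h.trans ?_) bot_le
    rw [← htail.liminf_eq]
    refine liminf_le_liminf ?_
    filter_upwards [eventually_ge_atTop N] with n hn
    rw [ENNReal.tsum_prod']
    exact ENNReal.tsum_le_tsum fun k => hN (k + n) (by omega)
  · refine Eventually.of_forall fun n α hα => ?_
    obtain ⟨hirr, hB, hM⟩ := hα
    obtain ⟨q, hqn, p, hq0, hp⟩ := exists_approx_of_not_brjuno hirr hB n
    refine Set.mem_iUnion.2 ⟨(q - n, p), ?_⟩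
    have hq0' : (0 : ℝ) < q := mod_cast hq0
    simp only [Nat.sub_add_cancel hqn]
    have hle1 : Real.exp (-(q / √(Real.log q))) ≤ 1 := by
      rw [Real.exp_le_one_iff, neg_nonpos]
      positivity
    have hpq : |(p : ℝ)| ≤ (M + 1) * q := by
      rw [← div_le_iff₀ hq0', ← abs_of_pos hq0', ← abs_div]
      have := abs_sub_abs_le_abs_sub ((p : ℝ) / q) α
      rw [abs_sub_comm] at this
      linarith
    rw [approxInterval, if_pos]
    · rw [abs_le] at hp
      exact ⟨by linarith, by linarith⟩
    · rw [Finset.mem_Icc, ← abs_le]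
      exact_mod_cast hpq

/-- For every `σ > 2`, the complement of the Brjuno set has zero Hausdorff measure with
respect to the gauge function `h¹_σ`. -/
theorem brjuno_complement_hausdorff_zero (σ : ℝ) (hσ : 2 < σ) :
    Measure.mkMetric (brjunoGauge σ) (BrjunoSetᶜ : Set ℝ) = 0 := by
  have hsub : BrjunoSetᶜ ⊆ Set.range ((↑) : ℚ → ℝ) ∪
      ⋃ M : ℕ, {α : ℝ | Irrational α ∧ α ∉ BrjunoSet ∧ |α| ≤ M} := by
    intro α hα
    by_cases hirr : Irrational α
    · obtain ⟨M, hM⟩ := exists_nat_ge |α|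
      exact Or.inr (Set.mem_iUnion.2 ⟨M, hirr, hα, hM⟩)
    · exact Or.inl (not_not.1 hirr)
  refine measure_mono_null hsub (measure_union_null ?_ (measure_iUnion_null fun M => ?_))
  · exact mkMetric_brjunoGauge_countable σ (Set.countable_range _)
  · exact mkMetric_brjunoGauge_bounded hσ M
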